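/- arXiv:2501.11981 — 9 statements merged into one kernel-verified Lean document; each statement's English description precedes it below -/
import Mathlib

section
/- On the reference square [−1,1]², the twelve Adini degrees of freedom are unisolvent on 𝒜: the linear map 𝒜 → ℝ¹² sending p to the tuple (p(z_j), ∂ₓp(z_j), ∂_yp(z_j)) for j = 1,…,4 is bijective. In particular, for every j ∈ {1,…,4} and every multi-index α ∈ {(0,0),(1,0),(0,1)} there exists a unique φ_{z_j,α} ∈ 𝒜 with ∂^β φ_{z_j,α}(z_k) = δ_{jk} δ_{αβ} for all k ∈ {1,…,4} and all multi-indices β with |β| ≤ 1. -/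
open MvPolynomial MeasureTheory

/-- The Adini shape-function space `𝒜 = P₃ + span{x³y, xy³}`, spanned by the
twelve monomials `1, x, y, x², xy, y², x³, x²y, xy², y³, x³y, xy³`. -/
noncomputable def AdiniSpace : Submodule ℝ (MvPolynomial (Fin 2) ℝ) :=
  Submodule.span ℝ
    ({1, X 0, X 1, X 0 ^ 2, X 0 * X 1, X 1 ^ 2, X 0 ^ 3, X 0 ^ 2 * X 1,
      X 0 * X 1 ^ 2, X 1 ^ 3, X 0 ^ 3 * X 1, X 0 * X 1 ^ 3} :
      Set (MvPolynomial (Fin 2) ℝ))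

/-- Evaluation of a polynomial in the two variables at the point `(x, y)`. -/
noncomputable def pev (x y : ℝ) (p : MvPolynomial (Fin 2) ℝ) : ℝ :=
  eval ![x, y] p

/-- Partial derivative `∂ₓ`. -/
noncomputable def dX : MvPolynomial (Fin 2) ℝ → MvPolynomial (Fin 2) ℝ :=
  pderiv (0 : Fin 2)

/-- Partial derivative `∂_y`. -/
noncomputable def dY : MvPolynomial (Fin 2) ℝ → MvPolynomial (Fin 2) ℝ :=
  pderiv (1 : Fin 2)

/-- The Adini degree of freedom at a vertex `v` with multi-index
`β = 0 ↔ (0,0)` (point value), `β = 1 ↔ (1,0)` (`∂ₓ`), `β = 2 ↔ (0,1)` (`∂_y`). -/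
noncomputable def adiniDof (β : Fin 3) (v : ℝ × ℝ) (p : MvPolynomial (Fin 2) ℝ) : ℝ :=
  if β = 0 then pev v.1 v.2 p else if β = 1 then pev v.1 v.2 (dX p) else pev v.1 v.2 (dY p)

/-- Vertices of the reference square `[−1,1]²`:
`z₁ = (−1,−1)`, `z₂ = (1,−1)`, `z₃ = (1,1)`, `z₄ = (−1,1)`. -/
noncomputable def refVertex : Fin 4 → ℝ × ℝ := ![(-1, -1), (1, -1), (1, 1), (-1, 1)]

/-- The Adini nodal function of the vertex `(a, b)` of `[−1,1]²` and the multi-index `α`,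
with `α` encoded as in `adiniDof`. -/
noncomputable def adiniNodal (a b : ℝ) (α : Fin 3) : MvPolynomial (Fin 2) ℝ :=
  (1 / 8 : ℝ) •
    ![(2 : ℝ) • 1 + (3 * a) • X 0 + (3 * b) • X 1 + (4 * a * b) • (X 0 * X 1) - a • X 0 ^ 3
        - b • X 1 ^ 3 - (a * b) • (X 0 ^ 3 * X 1) - (a * b) • (X 0 * X 1 ^ 3),
      X 0 ^ 3 + a • X 0 ^ 2 - X 0 - a • 1
        + b • (X 0 ^ 3 * X 1) + (a * b) • (X 0 ^ 2 * X 1) - b • (X 0 * X 1) - (a * b) • X 1,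
      X 1 ^ 3 + b • X 1 ^ 2 - X 1 - b • 1
        + a • (X 0 * X 1 ^ 3) + (a * b) • (X 0 * X 1 ^ 2) - a • (X 0 * X 1) - (a * b) • X 0] α

theorem adiniNodal_mem (a b : ℝ) (α : Fin 3) : adiniNodal a b α ∈ AdiniSpace := by
  apply Submodule.smul_mem
  fin_cases α <;>
    · dsimp
      repeat' first
        | with_reducible apply Submodule.add_mem
        | with_reducible apply Submodule.sub_mem
        | with_reducible apply Submodule.smul_mem
        | exact Submodule.subset_span (by
            simp only [Set.mem_insert_iff, Set.mem_singleton_iff, true_or, or_true])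

/-- The Adini degrees of freedom of the nodal functions at an arbitrary point. -/
theorem adiniDof_adiniNodal (a b s t : ℝ) (α β : Fin 3) :
    adiniDof β (s, t) (adiniNodal a b α) = 1 / 8 *
      ![![2 + 3 * a * s + 3 * b * t + 4 * a * b * (s * t) - a * s ^ 3 - b * t ^ 3
            - a * b * (s ^ 3 * t) - a * b * (s * t ^ 3),
          3 * a + 4 * a * b * t - 3 * a * s ^ 2 - 3 * a * b * (s ^ 2 * t) - a * b * t ^ 3,
          3 * b + 4 * a * b * s - 3 * b * t ^ 2 - a * b * s ^ 3 - 3 * a * b * (s * t ^ 2)],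
        ![(s ^ 3 + a * s ^ 2 - s - a) * (1 + b * t),
          (3 * s ^ 2 + 2 * a * s - 1) * (1 + b * t),
          (s ^ 3 + a * s ^ 2 - s - a) * b],
        ![(t ^ 3 + b * t ^ 2 - t - b) * (1 + a * s),
          (t ^ 3 + b * t ^ 2 - t - b) * a,
          (3 * t ^ 2 + 2 * b * t - 1) * (1 + a * s)]] α β := by
  fin_cases α <;> fin_cases β <;>
    simp [adiniDof, adiniNodal, pev, dX, dY, pderiv_X, Derivation.leibniz,
      Derivation.leibniz_pow, smul_eval] <;> ring

theorem adiniDof_refVertex_adiniNodal (j k : Fin 4) (α β : Fin 3) :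
    adiniDof β (refVertex k) (adiniNodal (refVertex j).1 (refVertex j).2 α) =
      if k = j ∧ β = α then 1 else 0 := by
  rw [← Prod.mk.eta (p := refVertex k), adiniDof_adiniNodal]
  fin_cases j <;> fin_cases k <;> fin_cases α <;> fin_cases β <;>
    norm_num [refVertex]

/-- The map sending `p ∈ 𝒜` to its twelve degrees of freedom on the reference square. -/
noncomputable def adiniDofMap : AdiniSpace →ₗ[ℝ] (Fin 4 × Fin 3 → ℝ) where
  toFun p jα := adiniDof jα.2 (refVertex jα.1) p
  map_add' p q := by
    ext jα
    simp only [adiniDof, pev, dX, dY, Submodule.coe_add, map_add, Pi.add_apply]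
    split_ifs <;> rfl
  map_smul' c p := by
    ext jα
    simp only [adiniDof, pev, dX, dY, Submodule.coe_smul, Derivation.map_smul, smul_eval,
      Pi.smul_apply, smul_eq_mul, RingHom.id_apply]
    split_ifs <;> rfl

theorem adiniDofMap_surjective : Function.Surjective adiniDofMap := by
  intro d
  refine ⟨∑ iα : Fin 4 × Fin 3, d iα • ⟨adiniNodal (refVertex iα.1).1 (refVertex iα.1).2 iα.2,
    adiniNodal_mem _ _ _⟩, ?_⟩
  ext jβ
  simp only [map_sum, map_smul, Finset.sum_apply, Pi.smul_apply, adiniDofMap, LinearMap.coe_mk,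
    AddHom.coe_mk, adiniDof_refVertex_adiniNodal, ← Prod.ext_iff, smul_eq_mul, mul_ite, mul_one,
    mul_zero, Finset.sum_ite_eq, Finset.mem_univ, if_true]

theorem adiniSpace_eq_span_range :
    AdiniSpace = Submodule.span ℝ (Set.range
      ![1, X 0, X 1, X 0 ^ 2, X 0 * X 1, X 1 ^ 2, X 0 ^ 3, X 0 ^ 2 * X 1,
        X 0 * X 1 ^ 2, X 1 ^ 3, X 0 ^ 3 * X 1, X 0 * X 1 ^ 3]) := by
  simp only [AdiniSpace, Matrix.range_cons, Matrix.range_empty, Set.union_empty,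
    Set.singleton_union]

instance finiteDimensional_adiniSpace : FiniteDimensional ℝ AdiniSpace := by
  rw [adiniSpace_eq_span_range]
  exact FiniteDimensional.span_of_finite ℝ (Set.finite_range _)

theorem finrank_adiniSpace_le : Module.finrank ℝ AdiniSpace ≤ 12 := by
  rw [adiniSpace_eq_span_range]
  exact finrank_range_le_card _

theorem adiniDofMap_bijective : Function.Bijective adiniDofMap := by
  have hrank : Module.finrank ℝ AdiniSpace = Module.finrank ℝ (Fin 4 × Fin 3 → ℝ) :=
    le_antisymm (by simpa using finrank_adiniSpace_le)
      (adiniDofMap.finrank_le_finrank_of_surjective adiniDofMap_surjective)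
  exact ⟨(LinearMap.injective_iff_surjective_of_finrank_eq_finrank hrank).2
    adiniDofMap_surjective, adiniDofMap_surjective⟩

/-- **Unisolvence of the Adini degrees of freedom.**
On the reference square `[−1,1]²`, the linear map `𝒜 → ℝ¹²` sending `p` to the
tuple of its twelve Adini degrees of freedom is bijective; in particular, for
every vertex index `j` and multi-index `α` there is a unique `φ ∈ 𝒜` with
`∂^β φ(z_k) = δ_{jk} δ_{αβ}`. -/
theorem adini_unisolvence :
    Function.Bijective
      (fun p : AdiniSpace => fun jα : Fin 4 × Fin 3 =>
        adiniDof jα.2 (refVertex jα.1) (p : MvPolynomial (Fin 2) ℝ)) ∧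
    ∀ (j : Fin 4) (α : Fin 3), ∃! φ : MvPolynomial (Fin 2) ℝ,
      φ ∈ AdiniSpace ∧
        ∀ (k : Fin 4) (β : Fin 3),
          adiniDof β (refVertex k) φ = if k = j ∧ β = α then 1 else 0 := by
  refine ⟨adiniDofMap_bijective, fun j α => ⟨_, ⟨adiniNodal_mem _ _ α,
    fun k β => adiniDof_refVertex_adiniNodal j k α β⟩, ?_⟩⟩
  rintro ψ ⟨hψ, hdof⟩
  refine congrArg Subtype.val (adiniDofMap_bijective.1
    (a₁ := ⟨ψ, hψ⟩) (a₂ := ⟨_, adiniNodal_mem _ _ α⟩) (funext fun kβ => ?_))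
  exact (hdof kβ.1 kβ.2).trans (adiniDof_refVertex_adiniNodal j kβ.1 α kβ.2).symm
end

section
/- Let w ∈ 𝒜 and let x₀ ∈ {m₁−h_x, m₁+h_x}, so that {x₀} × [m₂−h_y, m₂+h_y] is an edge of T orthogonal to the x-axis. For η ∈ [−1,1] set y(η) = m₂ + h_y·η and define the affine interpolant (Q∂ₓw)(η) = ((1−η)/2)·∂ₓw(x₀, m₂−h_y) + ((1+η)/2)·∂ₓw(x₀, m₂+h_y). Then for all η ∈ [−1,1]: ∂ₓw(x₀, y(η)) − (Q∂ₓw)(η) = −(h_y³/3)·∂⁴ₓᵧᵧᵧw·(η³−η) + (h_y²/2)·∂³ₓᵧᵧw(x₀, y(η))·(η²−1), where ∂⁴ₓᵧᵧᵧw denotes the constant fourth mixed derivative of w and ∂³ₓᵧᵧw(x₀, y(η)) is independent of the first argument. -/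
open MvPolynomial MeasureTheory

/-- **Interpolation error of `∂ₓw` on a vertical edge (Lemma l:Qdx).**
For `w ∈ 𝒜` and a vertical edge `{x₀} × [m₂−h_y, m₂+h_y]` of the rectangle
`T`, the difference between `∂ₓw` and its affine interpolant along the edge is
`−(h_y³/3)∂⁴ₓᵧᵧᵧw(η³−η) + (h_y²/2)∂³ₓᵧᵧw(η²−1)`; moreover `∂⁴ₓᵧᵧᵧw` is a
constant and `∂³ₓᵧᵧw` is independent of `x`. -/
theorem adini_edge_interpolation (m₁ m₂ hx hy : ℝ) (hhx : 0 < hx) (hhy : 0 < hy)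
    (w : MvPolynomial (Fin 2) ℝ) (hw : w ∈ AdiniSpace)
    (x₀ : ℝ) (hx₀ : x₀ = m₁ - hx ∨ x₀ = m₁ + hx) :
    (∃ cst : ℝ, dY (dY (dY (dX w))) = C cst) ∧
    dX (dY (dY (dX w))) = 0 ∧
    ∀ η ∈ Set.Icc (-1 : ℝ) 1,
      pev x₀ (m₂ + hy * η) (dX w)
        - ((1 - η) / 2 * pev x₀ (m₂ - hy) (dX w)
            + (1 + η) / 2 * pev x₀ (m₂ + hy) (dX w))
      = -(hy ^ 3 / 3) * pev x₀ (m₂ + hy * η) (dY (dY (dY (dX w)))) * (η ^ 3 - η)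
        + hy ^ 2 / 2 * pev x₀ (m₂ + hy * η) (dY (dY (dX w))) * (η ^ 2 - 1) := by
  unfold AdiniSpace at hw
  have h01 : pderiv (R := ℝ) (0 : Fin 2) (X 1) = 0 := pderiv_X_of_ne (by decide)
  have h10 : pderiv (R := ℝ) (1 : Fin 2) (X 0) = 0 := pderiv_X_of_ne (by decide)
  have hnum (i : Fin 2) (n : ℕ) [n.AtLeastTwo] :
      pderiv (R := ℝ) i (OfNat.ofNat n : MvPolynomial (Fin 2) ℝ) = 0 :=
    (pderiv i).map_natCast n
  induction hw using Submodule.span_induction with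
  | mem p hp =>
    simp only [Set.mem_insert_iff, Set.mem_singleton_iff] at hp
    rcases hp with rfl | rfl | rfl | rfl | rfl | rfl | rfl | rfl | rfl | rfl | rfl | rfl <;>
    simp only [dX, dY, pev, Derivation.leibniz, Derivation.leibniz_pow, Derivation.map_one_eq_zero,
      pderiv_X_self, h01, h10, hnum, map_ofNat, map_zero, map_one, map_mul, map_pow,
      smul_zero, smul_eq_mul, nsmul_eq_mul, mul_one, mul_zero, zero_mul, add_zero, zero_add,
      eval_X, Matrix.cons_val_zero, Matrix.cons_val_one, Nat.cast_ofNat, Nat.add_one_sub_one,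
      pow_one]
    all_goals
      refine ⟨?_, trivial, fun η _ => by ring⟩
      first
      | exact ⟨0, C_0.symm⟩
      | exact ⟨6, by rw [map_ofNat]; norm_num⟩
  | zero =>
    exact ⟨⟨0, by simp [dX, dY]⟩, by simp [dX, dY], fun η _ => by simp [dX, dY, pev]⟩
  | add p q _ _ hp hq =>
    obtain ⟨⟨a, ha⟩, hpx, hpη⟩ := hp
    obtain ⟨⟨b, hb⟩, hqx, hqη⟩ := hq
    simp only [dX, dY, pev, map_add] at *
    refine ⟨⟨a + b, by rw [ha, hb, map_add]⟩, by rw [hpx, hqx, add_zero], fun η hη => ?_⟩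
    linear_combination hpη η hη + hqη η hη
  | smul c p _ hp =>
    obtain ⟨⟨a, ha⟩, hpx, hpη⟩ := hp
    simp only [dX, dY, pev, Derivation.map_smul, smul_eval] at *
    refine ⟨⟨c * a, by rw [ha, smul_eq_C_mul, map_mul]⟩, by rw [hpx, smul_zero], fun η hη => ?_⟩
    linear_combination c * hpη η hη
end

section
/- Let w ∈ 𝒜 and let g be a continuously differentiable real-valued function on a neighbourhood of T. On each vertical edge of T let Q∂ₓw denote the affine-in-y interpolant matching the values of ∂ₓw at the two endpoints of that edge. Then, with η(y) = (y−m₂)/h_y: ∫_{m₂−h_y}^{m₂+h_y} g(m₁+h_x, y)·(∂ₓw − Q∂ₓw)(m₁+h_x, y) dy − ∫_{m₂−h_y}^{m₂+h_y} g(m₁−h_x, y)·(∂ₓw − Q∂ₓw)(m₁−h_x, y) dy = −(h_y³/3)·∫_T ∂ₓg·∂⁴ₓᵧᵧᵧw·(η(y)³−η(y)) dx dy + (h_y²/2)·∫_T ∂ₓg·∂³ₓᵧᵧw·(η(y)²−1) dx dy. -/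
open MvPolynomial MeasureTheory

theorem exists_pev_dX_eq_of_mem_adiniSpace {w : MvPolynomial (Fin 2) ℝ} (hw : w ∈ AdiniSpace) :
    ∃ (a b : ℝ → ℝ) (c d : ℝ), ∀ x y : ℝ,
      pev x y (dX w) = a x + b x * y + c * y ^ 2 + d * y ^ 3 ∧
      pev x y (dY (dY (dX w))) = 2 * c + 6 * d * y ∧
      pev x y (dY (dY (dY (dX w)))) = 6 * d := by
  unfold AdiniSpace at hw
  induction hw using Submodule.span_induction with
  | mem p hp =>
    simp only [Set.mem_insert_iff, Set.mem_singleton_iff] at hp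
    have hX1 : pderiv (0 : Fin 2) (X 1 : MvPolynomial (Fin 2) ℝ) = 0 :=
      pderiv_X_of_ne (by decide)
    have hX0 : pderiv (1 : Fin 2) (X 0 : MvPolynomial (Fin 2) ℝ) = 0 :=
      pderiv_X_of_ne (by decide)
    have h_two : pderiv (1 : Fin 2) (2 : MvPolynomial (Fin 2) ℝ) = 0 :=
      (pderiv 1).map_natCast 2
    have h_three : pderiv (1 : Fin 2) (3 : MvPolynomial (Fin 2) ℝ) = 0 :=
      (pderiv 1).map_natCast 3
    rcases hp with rfl | rfl | rfl | rfl | rfl | rfl | rfl | rfl | rfl | rfl | rfl | rfl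
    on_goal 1 => refine ⟨fun _ => 0, fun _ => 0, 0, 0, fun x y => ?_⟩
    on_goal 2 => refine ⟨fun _ => 1, fun _ => 0, 0, 0, fun x y => ?_⟩
    on_goal 3 => refine ⟨fun _ => 0, fun _ => 0, 0, 0, fun x y => ?_⟩
    on_goal 4 => refine ⟨fun x => 2 * x, fun _ => 0, 0, 0, fun x y => ?_⟩
    on_goal 5 => refine ⟨fun _ => 0, fun _ => 1, 0, 0, fun x y => ?_⟩
    on_goal 6 => refine ⟨fun _ => 0, fun _ => 0, 0, 0, fun x y => ?_⟩
    on_goal 7 => refine ⟨fun x => 3 * x ^ 2, fun _ => 0, 0, 0, fun x y => ?_⟩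
    on_goal 8 => refine ⟨fun _ => 0, fun x => 2 * x, 0, 0, fun x y => ?_⟩
    on_goal 9 => refine ⟨fun _ => 0, fun _ => 0, 1, 0, fun x y => ?_⟩
    on_goal 10 => refine ⟨fun _ => 0, fun _ => 0, 0, 0, fun x y => ?_⟩
    on_goal 11 => refine ⟨fun _ => 0, fun x => 3 * x ^ 2, 0, 0, fun x y => ?_⟩
    on_goal 12 => refine ⟨fun _ => 0, fun _ => 0, 0, 1, fun x y => ?_⟩
    all_goals
      simp [pev, dX, dY, Derivation.leibniz, Derivation.leibniz_pow, hX1, hX0, h_two, h_three]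
    all_goals
      try constructorm* _ ∧ _
      all_goals ring
  | zero => exact ⟨fun _ => 0, fun _ => 0, 0, 0, by simp [pev, dX, dY]⟩
  | add p q _ _ hp hq =>
    obtain ⟨a, b, c, d, h⟩ := hp
    obtain ⟨a', b', c', d', h'⟩ := hq
    refine ⟨a + a', b + b', c + c', d + d', fun x y => ?_⟩
    obtain ⟨h₁, h₂, h₃⟩ := h x y
    obtain ⟨h₁', h₂', h₃'⟩ := h' x y
    simp only [pev, dX, dY, map_add, Pi.add_apply] at *
    rw [h₁, h₂, h₃, h₁', h₂', h₃']
    refine ⟨?_, ?_, ?_⟩ <;> ring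
  | smul r p _ hp =>
    obtain ⟨a, b, c, d, h⟩ := hp
    refine ⟨r • a, r • b, r * c, r * d, fun x y => ?_⟩
    obtain ⟨h₁, h₂, h₃⟩ := h x y
    simp only [pev, dX, dY, Derivation.map_smul, smul_eval, Pi.smul_apply, smul_eq_mul] at *
    rw [h₁, h₂, h₃]
    refine ⟨?_, ?_, ?_⟩ <;> ring

theorem ContinuousOn.integrableOn_Ioc_prod_Ioc {F : ℝ × ℝ → ℝ} {a b c d : ℝ}
    (hF : ContinuousOn F (Set.Icc a b ×ˢ Set.Icc c d)) :
    IntegrableOn F (Set.Ioc a b ×ˢ Set.Ioc c d) (volume.prod volume) :=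
  (hF.integrableOn_compact (isCompact_Icc.prod isCompact_Icc)).mono_set
    (Set.prod_mono Set.Ioc_subset_Icc_self Set.Ioc_subset_Icc_self)

theorem ContinuousOn.intervalIntegral_intervalIntegral {F : ℝ × ℝ → ℝ} {a b c d : ℝ}
    (hab : a ≤ b) (hcd : c ≤ d) (hF : ContinuousOn F (Set.Icc a b ×ˢ Set.Icc c d)) :
    ∫ x in a..b, ∫ y in c..d, F (x, y) =
      ∫ p in Set.Ioc a b ×ˢ Set.Ioc c d, F p ∂(volume.prod volume) := by
  simp only [intervalIntegral.integral_of_le hab, intervalIntegral.integral_of_le hcd]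
  exact (setIntegral_prod F hF.integrableOn_Ioc_prod_Ioc).symm

theorem ContinuousOn.intervalIntegral_intervalIntegral_symm {F : ℝ × ℝ → ℝ} {a b c d : ℝ}
    (hab : a ≤ b) (hcd : c ≤ d) (hF : ContinuousOn F (Set.Icc a b ×ˢ Set.Icc c d)) :
    ∫ y in c..d, ∫ x in a..b, F (x, y) =
      ∫ p in Set.Ioc a b ×ˢ Set.Ioc c d, F p ∂(volume.prod volume) := by
  have hint := hF.integrableOn_Ioc_prod_Ioc
  rw [IntegrableOn, ← Measure.prod_restrict] at hint
  simp only [intervalIntegral.integral_of_le hab, intervalIntegral.integral_of_le hcd]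
  rw [← Measure.prod_restrict]
  exact (integral_prod_symm F hint).symm

/-- Fundamental theorem of calculus along a horizontal segment. -/
theorem intervalIntegral_fderiv_fst {g : ℝ × ℝ → ℝ} {U : Set (ℝ × ℝ)} (hU : IsOpen U)
    (hg : ContDiffOn ℝ 1 g U) {a b y : ℝ} (hab : a ≤ b) (hy : ∀ x ∈ Set.Icc a b, (x, y) ∈ U) :
    ∫ x in a..b, fderiv ℝ g (x, y) (1, 0) = g (b, y) - g (a, y) := by
  have hcont : ContinuousOn (fun x => fderiv ℝ g (x, y) (1, 0)) (Set.Icc a b) :=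
    ((hg.continuousOn_fderiv_of_isOpen hU le_rfl).comp (by fun_prop) hy).clm_apply
      continuousOn_const
  refine intervalIntegral.integral_eq_sub_of_hasDerivAt (f := fun x => g (x, y))
    (fun x hx => ?_) ?_
  · rw [Set.uIcc_of_le hab] at hx
    have hd : HasFDerivAt g (fderiv ℝ g (x, y)) (x, y) :=
      ((hg.differentiableOn one_ne_zero).differentiableAt (hU.mem_nhds (hy x hx))).hasFDerivAt
    exact hd.comp_hasDerivAt x ((hasDerivAt_id x).prodMk (hasDerivAt_const x y))
  · rw [← Set.uIcc_of_le hab] at hcont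
    exact hcont.intervalIntegrable

/-- **Boundary consistency identity (from the proof of Lemma l:consist).**
For `w ∈ 𝒜` and a `C¹` function `g` on a neighbourhood of the rectangle `T`,
the weighted boundary integral of `(1−Q)∂ₓw` over the two vertical edges equals
the two volume integrals involving `∂ₓg`. -/
theorem adini_consistency_identity (m₁ m₂ hx hy : ℝ) (hhx : 0 < hx) (hhy : 0 < hy)
    (w : MvPolynomial (Fin 2) ℝ) (hw : w ∈ AdiniSpace)
    (g : ℝ × ℝ → ℝ) (U : Set (ℝ × ℝ)) (hU : IsOpen U)
    (hTU : Set.Icc (m₁ - hx) (m₁ + hx) ×ˢ Set.Icc (m₂ - hy) (m₂ + hy) ⊆ U)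
    (hg : ContDiffOn ℝ 1 g U) :
    (∫ y in (m₂ - hy)..(m₂ + hy),
        g (m₁ + hx, y) *
          (pev (m₁ + hx) y (dX w)
            - ((m₂ + hy - y) / (2 * hy) * pev (m₁ + hx) (m₂ - hy) (dX w)
              + (y - (m₂ - hy)) / (2 * hy) * pev (m₁ + hx) (m₂ + hy) (dX w))))
    - (∫ y in (m₂ - hy)..(m₂ + hy),
        g (m₁ - hx, y) *
          (pev (m₁ - hx) y (dX w)
            - ((m₂ + hy - y) / (2 * hy) * pev (m₁ - hx) (m₂ - hy) (dX w)
              + (y - (m₂ - hy)) / (2 * hy) * pev (m₁ - hx) (m₂ + hy) (dX w))))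
    = -(hy ^ 3 / 3) *
        (∫ x in (m₁ - hx)..(m₁ + hx), ∫ y in (m₂ - hy)..(m₂ + hy),
          fderiv ℝ g (x, y) (1, 0) * pev x y (dY (dY (dY (dX w)))) *
            (((y - m₂) / hy) ^ 3 - (y - m₂) / hy))
      + hy ^ 2 / 2 *
        (∫ x in (m₁ - hx)..(m₁ + hx), ∫ y in (m₂ - hy)..(m₂ + hy),
          fderiv ℝ g (x, y) (1, 0) * pev x y (dY (dY (dX w))) *
            (((y - m₂) / hy) ^ 2 - 1)) := by
  obtain ⟨a, b, c, d, hw'⟩ := exists_pev_dX_eq_of_mem_adiniSpace hw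
  have hpx : ∀ x y, pev x y (dX w) = a x + b x * y + c * y ^ 2 + d * y ^ 3 :=
    fun x y => (hw' x y).1
  have hpxyy : ∀ x y, pev x y (dY (dY (dX w))) = 2 * c + 6 * d * y := fun x y => (hw' x y).2.1
  have hpxyyy : ∀ x y, pev x y (dY (dY (dY (dX w)))) = 6 * d := fun x y => (hw' x y).2.2
  simp only [hpx, hpxyy, hpxyyy]
  have hX : m₁ - hx ≤ m₁ + hx := by linarith
  have hY : m₂ - hy ≤ m₂ + hy := by linarith
  have hy0 : hy ≠ 0 := hhy.ne'
  set φ : ℝ → ℝ := fun y => d * hy ^ 3 * (((y - m₂) / hy) ^ 3 - (y - m₂) / hy)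
    + (c + 3 * d * m₂) * hy ^ 2 * (((y - m₂) / hy) ^ 2 - 1) with hφ
  have hφc : Continuous φ := by fun_prop
  have hQ : ∀ x y : ℝ, a x + b x * y + c * y ^ 2 + d * y ^ 3
      - ((m₂ + hy - y) / (2 * hy) *
          (a x + b x * (m₂ - hy) + c * (m₂ - hy) ^ 2 + d * (m₂ - hy) ^ 3)
        + (y - (m₂ - hy)) / (2 * hy) *
          (a x + b x * (m₂ + hy) + c * (m₂ + hy) ^ 2 + d * (m₂ + hy) ^ 3)) = φ y := by
    intro x y
    simp only [hφ]
    field_simp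
    ring
  simp only [hQ]
  have hDg : ContinuousOn (fun p : ℝ × ℝ => fderiv ℝ g p (1, 0))
      (Set.Icc (m₁ - hx) (m₁ + hx) ×ˢ Set.Icc (m₂ - hy) (m₂ + hy)) :=
    ((hg.continuousOn_fderiv_of_isOpen hU le_rfl).mono hTU).clm_apply continuousOn_const
  have hF₁ := (hDg.mul (continuousOn_const (c := 6 * d))).mul
    (g := fun p => ((p.2 - m₂) / hy) ^ 3 - (p.2 - m₂) / hy)
    (Continuous.continuousOn (by fun_prop))
  have hF₂ := (hDg.mul (g := fun p => 2 * c + 6 * d * p.2)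
      (Continuous.continuousOn (by fun_prop))).mul
    (g := fun p => ((p.2 - m₂) / hy) ^ 2 - 1) (Continuous.continuousOn (by fun_prop))
  have hF := hDg.mul (g := fun p => φ p.2) (Continuous.continuousOn (by fun_prop))
  have hedge : ∀ x ∈ Set.Icc (m₁ - hx) (m₁ + hx),
      IntervalIntegrable (fun y => g (x, y) * φ y) volume (m₂ - hy) (m₂ + hy) := by
    intro x hx'
    refine ContinuousOn.intervalIntegrable ?_
    rw [Set.uIcc_of_le hY]
    exact (hg.continuousOn.comp (by fun_prop) fun y hy' => hTU ⟨hx', hy'⟩).mul hφc.continuousOn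
  have hinner : ∀ y ∈ Set.uIcc (m₂ - hy) (m₂ + hy),
      g (m₁ + hx, y) * φ y - g (m₁ - hx, y) * φ y =
        ∫ x in (m₁ - hx)..(m₁ + hx), fderiv ℝ g (x, y) (1, 0) * φ y := by
    intro y hy'
    rw [Set.uIcc_of_le hY] at hy'
    rw [intervalIntegral.integral_mul_const,
      intervalIntegral_fderiv_fst hU hg hX fun x hx' => hTU ⟨hx', hy'⟩, sub_mul]
  rw [← intervalIntegral.integral_sub (hedge _ ⟨hX, le_rfl⟩) (hedge _ ⟨le_rfl, hX⟩),
    intervalIntegral.integral_congr hinner]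
  refine (hF.intervalIntegral_intervalIntegral_symm hX hY).trans (Eq.trans ?_
    (congrArg₂ (fun s t => -(hy ^ 3 / 3) * s + hy ^ 2 / 2 * t)
      (hF₁.intervalIntegral_intervalIntegral hX hY)
      (hF₂.intervalIntegral_intervalIntegral hX hY)).symm)
  simp only [← integral_const_mul]
  rw [← integral_add (hF₁.integrableOn_Ioc_prod_Ioc.const_mul _)
    (hF₂.integrableOn_Ioc_prod_Ioc.const_mul _)]
  congr 1
  ext p
  simp only [hφ, Pi.mul_apply]
  field_simp
  ring
end

section
/- For every Lebesgue-integrable function q : [0,c] → ℝ one has ∫_T q(y)·∂²ₓₓφ(x,y) dx dy = 0. -/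
open MvPolynomial MeasureTheory

/-- The first and second `x`-derivatives of a function in the Adini space: `∂²ₓₓ` is affine in
each variable, and the increment of `∂ₓ` from `0` to `x` is its explicit primitive. -/
lemma AdiniSpace.exists_dX_dX_eq {φ : MvPolynomial (Fin 2) ℝ} (hφ : φ ∈ AdiniSpace) :
    ∃ p₀ p₁ r₀ r₁ : ℝ, ∀ x y : ℝ,
      pev x y (dX (dX φ)) = p₀ + p₁ * y + (r₀ + r₁ * y) * x ∧
      pev x y (dX φ) - pev 0 y (dX φ) = (p₀ + p₁ * y) * x + (r₀ + r₁ * y) * x ^ 2 / 2 := by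
  induction hφ using Submodule.span_induction with
  | mem φ h =>
    simp only [Set.mem_insert_iff, Set.mem_singleton_iff] at h
    rcases h with rfl | rfl | rfl | rfl | rfl | rfl | rfl | rfl | rfl | rfl | rfl | rfl
    on_goal 1 => refine ⟨0, 0, 0, 0, fun x y => ?_⟩
    on_goal 2 => refine ⟨0, 0, 0, 0, fun x y => ?_⟩
    on_goal 3 => refine ⟨0, 0, 0, 0, fun x y => ?_⟩
    on_goal 4 => refine ⟨2, 0, 0, 0, fun x y => ?_⟩
    on_goal 5 => refine ⟨0, 0, 0, 0, fun x y => ?_⟩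
    on_goal 6 => refine ⟨0, 0, 0, 0, fun x y => ?_⟩
    on_goal 7 => refine ⟨0, 0, 6, 0, fun x y => ?_⟩
    on_goal 8 => refine ⟨0, 2, 0, 0, fun x y => ?_⟩
    on_goal 9 => refine ⟨0, 0, 0, 0, fun x y => ?_⟩
    on_goal 10 => refine ⟨0, 0, 0, 0, fun x y => ?_⟩
    on_goal 11 => refine ⟨0, 0, 0, 6, fun x y => ?_⟩
    on_goal 12 => refine ⟨0, 0, 0, 0, fun x y => ?_⟩
    all_goals
      have h₂ : pderiv (0 : Fin 2) (2 : MvPolynomial (Fin 2) ℝ) = 0 :=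
        Derivation.map_natCast _ 2
      have h₃ : pderiv (0 : Fin 2) (3 : MvPolynomial (Fin 2) ℝ) = 0 :=
        Derivation.map_natCast _ 3
      constructor <;>
        simp [pev, dX, pderiv_X, Derivation.leibniz, Derivation.leibniz_pow, h₂, h₃] <;> ring
  | zero => exact ⟨0, 0, 0, 0, by simp [pev, dX]⟩
  | add φ ψ _ _ hφ hψ =>
    obtain ⟨p₀, p₁, r₀, r₁, hφ⟩ := hφ
    obtain ⟨s₀, s₁, t₀, t₁, hψ⟩ := hψ
    refine ⟨p₀ + s₀, p₁ + s₁, r₀ + t₀, r₁ + t₁, fun x y => ?_⟩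
    have hφ := hφ x y
    have hψ := hψ x y
    simp only [pev, dX, map_add] at hφ hψ ⊢
    constructor
    · linear_combination hφ.1 + hψ.1
    · linear_combination hφ.2 + hψ.2
  | smul k φ _ hφ =>
    obtain ⟨p₀, p₁, r₀, r₁, hφ⟩ := hφ
    refine ⟨k * p₀, k * p₁, k * r₀, k * r₁, fun x y => ?_⟩
    have hφ := hφ x y
    simp only [pev, dX, Derivation.map_smul, smul_eval] at hφ ⊢
    constructor
    · linear_combination k * hφ.1
    · linear_combination k * hφ.2

/-- **Lemma l:nodalintegral (a).** For the nodal Adini basis function `φ` of the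
vertex `z = (0,0)` on `T = [0,a] × [0,c]` and any integrable `q = q(y)`,
`∫_T q(y) ∂²ₓₓφ = 0`. -/
theorem adini_nodal_dxx_orth (a b c : ℝ) (ha : 0 < a) (hb : 0 < b) (hc : 0 < c)
    (φ : MvPolynomial (Fin 2) ℝ) (hφA : φ ∈ AdiniSpace)
    (hφ0 : ∀ β : Fin 3, adiniDof β (0, 0) φ = if β = 0 then 1 else 0)
    (hφv : ∀ β : Fin 3,
      adiniDof β (a, 0) φ = 0 ∧ adiniDof β (a, c) φ = 0 ∧ adiniDof β (0, c) φ = 0)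
    (q : ℝ → ℝ) (hq : IntegrableOn q (Set.Icc 0 c)) :
    (∫ x in (0 : ℝ)..a, ∫ y in (0 : ℝ)..c, q y * pev x y (dX (dX φ))) = 0 := by
  obtain ⟨p₀, p₁, r₀, r₁, hφ⟩ := AdiniSpace.exists_dX_dX_eq hφA
  have hdX : pev 0 0 (dX φ) = 0 ∧ pev a 0 (dX φ) = 0 ∧ pev a c (dX φ) = 0 ∧
      pev 0 c (dX φ) = 0 := by
    have h := hφv 1
    have h0 := hφ0 1
    simp only [adiniDof, one_ne_zero, if_false, if_true] at h h0
    exact ⟨h0, h⟩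
  obtain ⟨h00, ha0, hac, h0c⟩ := hdX
  have e0 := (hφ a 0).2
  have ec := (hφ a c).2
  rw [ha0, h00] at e0
  rw [hac, h0c] at ec
  have hp₀ : p₀ = -(r₀ * (a / 2)) := by
    apply mul_left_cancel₀ ha.ne'
    linear_combination -e0
  have hp₁ : p₁ = -(r₁ * (a / 2)) := by
    apply mul_left_cancel₀ (mul_pos ha hc).ne'
    linear_combination e0 - ec
  have hxx : ∀ x y : ℝ, q y * pev x y (dX (dX φ)) = (x - a / 2) * (q y * (r₀ + r₁ * y)) := by
    intro x y
    rw [(hφ x y).1, hp₀, hp₁]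
    ring
  simp only [hxx, intervalIntegral.integral_const_mul, intervalIntegral.integral_mul_const]
  rw [intervalIntegral.integral_sub (by simp) (by simp)]
  simp only [integral_id, intervalIntegral.integral_const, smul_eq_mul]
  ring
end

section
/- ∫_T x·∂²ₓₓφ(x,y) dx dy + ∫_K x·∂²ₓₓψ(x,y) dx dy = 0. -/
open MvPolynomial MeasureTheory

/-- Every element of the Adini space is a combination of its twelve monomials. -/
theorem exists_coeff_of_mem_AdiniSpace {p : MvPolynomial (Fin 2) ℝ} (hp : p ∈ AdiniSpace) :
    ∃ k : Fin 12 → ℝ, p = C (k 0) + C (k 1) * X 0 + C (k 2) * X 1 + C (k 3) * X 0 ^ 2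
      + C (k 4) * (X 0 * X 1) + C (k 5) * X 1 ^ 2 + C (k 6) * X 0 ^ 3
      + C (k 7) * (X 0 ^ 2 * X 1) + C (k 8) * (X 0 * X 1 ^ 2) + C (k 9) * X 1 ^ 3
      + C (k 10) * (X 0 ^ 3 * X 1) + C (k 11) * (X 0 * X 1 ^ 3) := by
  simp only [AdiniSpace, Submodule.mem_span_insert, Submodule.mem_span_singleton] at hp
  obtain ⟨k0, _, ⟨k1, _, ⟨k2, _, ⟨k3, _, ⟨k4, _, ⟨k5, _, ⟨k6, _, ⟨k7, _, ⟨k8, _, ⟨k9, _,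
    ⟨k10, _, ⟨k11, rfl⟩, rfl⟩, rfl⟩, rfl⟩, rfl⟩, rfl⟩, rfl⟩, rfl⟩, rfl⟩, rfl⟩, rfl⟩, rfl⟩ := hp
  refine ⟨![k0, k1, k2, k3, k4, k5, k6, k7, k8, k9, k10, k11], ?_⟩
  simp [smul_eq_C_mul]
  ring

/-- The Adini nodal function of the vertex `(0, 0)` on the rectangle with opposite vertex `(h, c)`
satisfies `∫ x ∂²ₓₓ = c / 2`, whatever the sign of `h`. -/
theorem integral_x_mul_dXX_nodal (h c : ℝ) {p : MvPolynomial (Fin 2) ℝ} (hp : p ∈ AdiniSpace)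
    (h0 : ∀ β : Fin 3, adiniDof β (0, 0) p = if β = 0 then 1 else 0)
    (hv : ∀ β : Fin 3,
      adiniDof β (h, 0) p = 0 ∧ adiniDof β (h, c) p = 0 ∧ adiniDof β (0, c) p = 0) :
    ∫ x in (0 : ℝ)..h, ∫ y in (0 : ℝ)..c, x * pev x y (dX (dX p)) = c / 2 := by
  obtain ⟨k, rfl⟩ := exists_coeff_of_mem_AdiniSpace hp
  have hxx (x y : ℝ) : x * pev x y (dX (dX (C (k 0) + C (k 1) * X 0 + C (k 2) * X 1
      + C (k 3) * X 0 ^ 2 + C (k 4) * (X 0 * X 1) + C (k 5) * X 1 ^ 2 + C (k 6) * X 0 ^ 3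
      + C (k 7) * (X 0 ^ 2 * X 1) + C (k 8) * (X 0 * X 1 ^ 2) + C (k 9) * X 1 ^ 3
      + C (k 10) * (X 0 ^ 3 * X 1) + C (k 11) * (X 0 * X 1 ^ 3))))
      = (2 * k 3 * x + 6 * k 6 * x ^ 2) + (2 * k 7 * x + 6 * k 10 * x ^ 2) * y := by
    have hnat (n : ℕ) [n.AtLeastTwo] :
        pderiv 0 (OfNat.ofNat n : MvPolynomial (Fin 2) ℝ) = 0 := (pderiv 0).map_natCast n
    simp [pev, dX, pderiv_X, hnat]
    ring
  have hy (x : ℝ) : ∫ y in (0 : ℝ)..c,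
      ((2 * k 3 * x + 6 * k 6 * x ^ 2) + (2 * k 7 * x + 6 * k 10 * x ^ 2) * y)
      = (2 * k 3 * c + k 7 * c ^ 2) * x + (6 * k 6 * c + 3 * k 10 * c ^ 2) * x ^ 2 := by
    rw [intervalIntegral.integral_add (by simp)
      ((by fun_prop : Continuous _).intervalIntegrable _ _), intervalIntegral.integral_const_mul]
    simp
    ring
  have hx : ∫ x in (0 : ℝ)..h,
      ((2 * k 3 * c + k 7 * c ^ 2) * x + (6 * k 6 * c + 3 * k 10 * c ^ 2) * x ^ 2)
      = (k 3 * c + k 7 * c ^ 2 / 2) * h ^ 2 + (2 * k 6 * c + k 10 * c ^ 2) * h ^ 3 := by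
    rw [intervalIntegral.integral_add ((by fun_prop : Continuous _).intervalIntegrable _ _)
      ((by fun_prop : Continuous _).intervalIntegrable _ _),
      intervalIntegral.integral_const_mul, intervalIntegral.integral_const_mul]
    simp
    ring
  simp only [hxx, hy, hx]
  simp [Fin.forall_fin_succ, adiniDof, pev, dX, dY, pderiv_X] at h0 hv
  obtain ⟨hk0, hk1, hk2⟩ := h0
  obtain ⟨⟨v1, v2, v3⟩, ⟨x1, x2, x3⟩, -⟩ := hv
  simp only [hk0, hk1, hk2] at v1 v2 v3 x1 x2 x3
  linear_combination c * (h * x1 - v1 + (h * x2 - h * x1 - h * x3) / 2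
    - (v2 - v1 - v3 - h * x3) / 2)

/-- **Lemma l:nodalintegral (b).** For the nodal Adini basis functions `φ`, `ψ`
of the shared vertex `z = (0,0)` on `T = [0,a] × [0,c]` and `K = [−b,0] × [0,c]`,
`∫_{T∪K} x ∂²ₓₓ = 0`. -/
theorem adini_nodal_xdxx_orth (a b c : ℝ) (ha : 0 < a) (hb : 0 < b) (hc : 0 < c)
    (φ ψ : MvPolynomial (Fin 2) ℝ) (hφA : φ ∈ AdiniSpace) (hψA : ψ ∈ AdiniSpace)
    (hφ0 : ∀ β : Fin 3, adiniDof β (0, 0) φ = if β = 0 then 1 else 0)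
    (hφv : ∀ β : Fin 3,
      adiniDof β (a, 0) φ = 0 ∧ adiniDof β (a, c) φ = 0 ∧ adiniDof β (0, c) φ = 0)
    (hψ0 : ∀ β : Fin 3, adiniDof β (0, 0) ψ = if β = 0 then 1 else 0)
    (hψv : ∀ β : Fin 3,
      adiniDof β (-b, 0) ψ = 0 ∧ adiniDof β (-b, c) ψ = 0 ∧ adiniDof β (0, c) ψ = 0) :
    (∫ x in (0 : ℝ)..a, ∫ y in (0 : ℝ)..c, x * pev x y (dX (dX φ)))
      + (∫ x in (-b : ℝ)..0, ∫ y in (0 : ℝ)..c, x * pev x y (dX (dX ψ))) = 0 := by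
  rw [integral_x_mul_dXX_nodal a c hφA hφ0 hφv, intervalIntegral.integral_symm,
    integral_x_mul_dXX_nodal (-b) c hψA hψ0 hψv, add_neg_cancel]
end

section
/- For every Lebesgue-integrable function q : [0,c] → ℝ one has ∫_T q(y)·∂²ₓᵧφ(x,y) dx dy + ∫_K q(y)·∂²ₓᵧψ(x,y) dx dy = 0. -/
open MvPolynomial MeasureTheory

/-- Coefficients of a polynomial of the Adini space and of the derivatives that matter here. -/
theorem exists_coeff_of_mem_adiniSpace {p : MvPolynomial (Fin 2) ℝ} (hp : p ∈ AdiniSpace) :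
    ∃ k00 k10 k01 k20 k11 k02 k30 k21 k12 k03 k31 k13 : ℝ, ∀ x y : ℝ,
      pev x y p = k00 + k10 * x + k20 * x ^ 2 + k30 * x ^ 3
        + (k01 + k11 * x + k21 * x ^ 2 + k31 * x ^ 3) * y
        + (k02 + k12 * x) * y ^ 2 + (k03 + k13 * x) * y ^ 3 ∧
      pev x y (dY p) = (k01 + k11 * x + k21 * x ^ 2 + k31 * x ^ 3)
        + 2 * (k02 + k12 * x) * y + 3 * (k03 + k13 * x) * y ^ 2 ∧
      pev x y (dY (dX p)) = (k11 + 2 * k21 * x + 3 * k31 * x ^ 2)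
        + 2 * k12 * y + 3 * k13 * y ^ 2 := by
  simp only [AdiniSpace, Submodule.mem_span_insert, Submodule.mem_span_singleton] at hp
  obtain ⟨k00, _, ⟨k10, _, ⟨k01, _, ⟨k20, _, ⟨k11, _, ⟨k02, _, ⟨k30, _, ⟨k21, _, ⟨k12, _,
    ⟨k03, _, ⟨k31, _, ⟨k13, rfl⟩, rfl⟩, rfl⟩, rfl⟩, rfl⟩, rfl⟩, rfl⟩, rfl⟩, rfl⟩, rfl⟩,
    rfl⟩, rfl⟩ := hp
  refine ⟨k00, k10, k01, k20, k11, k02, k30, k21, k12, k03, k31, k13, fun x y => ?_⟩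
  have pderiv_ofNat (i : Fin 2) (n : ℕ) [n.AtLeastTwo] :
      pderiv i (ofNat(n) : MvPolynomial (Fin 2) ℝ) = 0 := Derivation.map_natCast _ n
  refine ⟨?_, ?_, ?_⟩ <;>
    simp [pev, dX, dY, Derivation.leibniz, Derivation.leibniz_pow, pderiv_X, pderiv_ofNat] <;> ring

/-- On each vertical line an Adini polynomial is a cubic in `y`, and the weighted integral of its
mixed derivative over a rectangle is the difference of the weighted integrals of its
`y`-derivative over the two vertical edges. -/
theorem exists_vertical_cubic_of_mem_adiniSpace {p : MvPolynomial (Fin 2) ℝ}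
    (hp : p ∈ AdiniSpace) :
    ∃ B₀ B₁ B₂ B₃ : ℝ → ℝ,
      (∀ x y, pev x y p = B₀ x + B₁ x * y + B₂ x * y ^ 2 + B₃ x * y ^ 3) ∧
      (∀ x y, pev x y (dY p) = B₁ x + 2 * B₂ x * y + 3 * B₃ x * y ^ 2) ∧
      ∀ (q : ℝ → ℝ) (c d s t : ℝ), IntervalIntegrable q volume c d →
        ∫ x in s..t, ∫ y in c..d, q y * pev x y (dY (dX p)) =
          (B₁ t - B₁ s) * (∫ y in c..d, q y) + 2 * (B₂ t - B₂ s) * (∫ y in c..d, q y * y)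
            + 3 * (B₃ t - B₃ s) * (∫ y in c..d, q y * y ^ 2) := by
  obtain ⟨k00, k10, k01, k20, k11, k02, k30, k21, k12, k03, k31, k13, h⟩ :=
    exists_coeff_of_mem_adiniSpace hp
  refine ⟨fun x => k00 + k10 * x + k20 * x ^ 2 + k30 * x ^ 3,
    fun x => k01 + k11 * x + k21 * x ^ 2 + k31 * x ^ 3, fun x => k02 + k12 * x,
    fun x => k03 + k13 * x, fun x y => (h x y).1, fun x y => (h x y).2.1, ?_⟩
  intro q c d s t hq
  have hq₁ : IntervalIntegrable (fun y => q y * y) volume c d :=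
    hq.mul_continuousOn continuousOn_id
  have hq₂ : IntervalIntegrable (fun y => q y * y ^ 2) volume c d :=
    hq.mul_continuousOn (by fun_prop)
  have inner : ∀ x, ∫ y in c..d, q y * pev x y (dY (dX p)) =
      (k11 + 2 * k21 * x + 3 * k31 * x ^ 2) * (∫ y in c..d, q y)
        + 2 * k12 * (∫ y in c..d, q y * y) + 3 * k13 * (∫ y in c..d, q y * y ^ 2) := by
    intro x
    simp only [← intervalIntegral.integral_const_mul]
    rw [← intervalIntegral.integral_add (hq.const_mul _) (hq₁.const_mul _),
      ← intervalIntegral.integral_add ((hq.const_mul _).add (hq₁.const_mul _)) (hq₂.const_mul _)]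
    refine intervalIntegral.integral_congr fun y _ => ?_
    simp only [(h x y).2.2]
    ring
  simp only [inner]
  generalize (∫ y in c..d, q y) = I₀
  generalize (∫ y in c..d, q y * y) = I₁
  generalize (∫ y in c..d, q y * y ^ 2) = I₂
  have hderiv : ∀ x ∈ Set.uIcc s t, HasDerivAt
      (fun x => (k11 * x + k21 * x ^ 2 + k31 * x ^ 3) * I₀ + 2 * k12 * I₁ * x + 3 * k13 * I₂ * x)
      ((k11 + 2 * k21 * x + 3 * k31 * x ^ 2) * I₀ + 2 * k12 * I₁ + 3 * k13 * I₂) x := by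
    intro x _
    have hx := hasDerivAt_id' x
    refine HasDerivAt.congr_deriv ((((((hx.const_mul k11).add ((hx.pow 2).const_mul k21)).add
      ((hx.pow 3).const_mul k31)).mul_const I₀).add (hx.const_mul (2 * k12 * I₁))).add
      (hx.const_mul (3 * k13 * I₂))) ?_
    simp only [Nat.cast_ofNat, Nat.add_one_sub_one]
    ring
  rw [intervalIntegral.integral_eq_sub_of_hasDerivAt hderiv
    (Continuous.intervalIntegrable (by fun_prop) _ _)]
  ring

/-- A cubic is determined by its values and first derivatives at `0` and `c ≠ 0`. -/
theorem cubic_hermite_unique {c A₀ A₁ A₂ A₃ D₀ D₁ D₂ D₃ : ℝ} (hc : c ≠ 0)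
    (h₀ : A₀ = D₀) (h₁ : A₁ = D₁)
    (hval : A₀ + A₁ * c + A₂ * c ^ 2 + A₃ * c ^ 3 = D₀ + D₁ * c + D₂ * c ^ 2 + D₃ * c ^ 3)
    (hder : A₁ + 2 * A₂ * c + 3 * A₃ * c ^ 2 = D₁ + 2 * D₂ * c + 3 * D₃ * c ^ 2) :
    A₂ = D₂ ∧ A₃ = D₃ := by
  subst h₀ h₁
  constructor
  · apply mul_right_cancel₀ (pow_ne_zero 2 hc)
    linear_combination 3 * hval - c * hder
  · apply mul_right_cancel₀ (pow_ne_zero 3 hc)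
    linear_combination c * hder - 2 * hval

/-- **Lemma l:nodalintegral (c).** For the nodal Adini basis functions `φ`, `ψ`
of the shared vertex `z = (0,0)` on `T = [0,a] × [0,c]` and `K = [−b,0] × [0,c]`
and any integrable `q = q(y)`, `∫_{T∪K} q(y) ∂²ₓᵧ = 0`. -/
theorem adini_nodal_dxy_orth (a b c : ℝ) (ha : 0 < a) (hb : 0 < b) (hc : 0 < c)
    (φ ψ : MvPolynomial (Fin 2) ℝ) (hφA : φ ∈ AdiniSpace) (hψA : ψ ∈ AdiniSpace)
    (hφ0 : ∀ β : Fin 3, adiniDof β (0, 0) φ = if β = 0 then 1 else 0)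
    (hφv : ∀ β : Fin 3,
      adiniDof β (a, 0) φ = 0 ∧ adiniDof β (a, c) φ = 0 ∧ adiniDof β (0, c) φ = 0)
    (hψ0 : ∀ β : Fin 3, adiniDof β (0, 0) ψ = if β = 0 then 1 else 0)
    (hψv : ∀ β : Fin 3,
      adiniDof β (-b, 0) ψ = 0 ∧ adiniDof β (-b, c) ψ = 0 ∧ adiniDof β (0, c) ψ = 0)
    (q : ℝ → ℝ) (hq : IntegrableOn q (Set.Icc 0 c)) :
    (∫ x in (0 : ℝ)..a, ∫ y in (0 : ℝ)..c, q y * pev x y (dY (dX φ)))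
      + (∫ x in (-b : ℝ)..0, ∫ y in (0 : ℝ)..c, q y * pev x y (dY (dX ψ))) = 0 := by
  obtain ⟨A₀, A₁, A₂, A₃, hA, hA', hAint⟩ := exists_vertical_cubic_of_mem_adiniSpace hφA
  obtain ⟨D₀, D₁, D₂, D₃, hD, hD', hDint⟩ := exists_vertical_cubic_of_mem_adiniSpace hψA
  have hqi : IntervalIntegrable q volume 0 c :=
    (intervalIntegrable_iff_integrableOn_Icc_of_le hc.le).2 hq
  rw [hAint q 0 c 0 a hqi, hDint q 0 c (-b) 0 hqi]
  have e₁ := hφ0 0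
  have e₂ := hφ0 2
  have e₃ := hψ0 0
  have e₄ := hψ0 2
  obtain ⟨f₁, f₂, f₃⟩ := hφv 0
  obtain ⟨g₁, g₂, g₃⟩ := hφv 2
  obtain ⟨r₁, r₂, r₃⟩ := hψv 0
  obtain ⟨s₁, s₂, s₃⟩ := hψv 2
  have h20 : (2 : Fin 3) ≠ 0 := by decide
  have h21 : (2 : Fin 3) ≠ 1 := by decide
  simp only [adiniDof, if_true, h20, h21, if_false, hA, hA'] at e₁ e₂ f₁ f₂ f₃ g₁ g₂ g₃
  simp only [adiniDof, if_true, h20, h21, if_false, hD, hD'] at e₃ e₄ r₁ r₂ r₃ s₁ s₂ s₃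
  have hAa₀ : A₀ a = 0 := by linear_combination f₁
  have hAa₁ : A₁ a = 0 := by linear_combination g₁
  have hDb₀ : D₀ (-b) = 0 := by linear_combination r₁
  have hDb₁ : D₁ (-b) = 0 := by linear_combination s₁
  have hAD₀ : A₀ 0 = D₀ 0 := by linear_combination e₁ - e₃
  have hAD₁ : A₁ 0 = D₁ 0 := by linear_combination e₂ - e₄
  obtain ⟨hAa₂, hAa₃⟩ := cubic_hermite_unique (A₂ := A₂ a) (A₃ := A₃ a) (D₂ := 0) (D₃ := 0) hc.ne'
    hAa₀ hAa₁
    (by linear_combination f₂) (by linear_combination g₂)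
  obtain ⟨hDb₂, hDb₃⟩ := cubic_hermite_unique (A₂ := D₂ (-b)) (A₃ := D₃ (-b)) (D₂ := 0)
    (D₃ := 0) hc.ne' hDb₀ hDb₁
    (by linear_combination r₂) (by linear_combination s₂)
  obtain ⟨hAD₂, hAD₃⟩ := cubic_hermite_unique hc.ne' hAD₀ hAD₁
    (f₃.trans r₃.symm) (g₃.trans s₃.symm)
  rw [hAa₁, hAa₂, hAa₃, hDb₁, hDb₂, hDb₃, hAD₁, hAD₂, hAD₃]
  ring
end

section
/- ∫_T x·∂²ₓₓφ(x,y) dx dy = 0. -/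
open MvPolynomial MeasureTheory

theorem pderiv_ofNat {R σ : Type*} [CommSemiring R] (i : σ) (n : ℕ) [n.AtLeastTwo] :
    pderiv i (ofNat(n) : MvPolynomial σ R) = 0 := by
  simpa only [Nat.cast_ofNat] using (pderiv (R := R) i).map_natCast (OfNat.ofNat n)

/-- Expansion of an Adini shape function in the monomial basis. -/
theorem AdiniSpace.exists_coeffs {φ : MvPolynomial (Fin 2) ℝ} (hφ : φ ∈ AdiniSpace) :
    ∃ k : Fin 12 → ℝ, φ = C (k 0) + C (k 1) * X 0 + C (k 2) * X 1 + C (k 3) * X 0 ^ 2 +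
      C (k 4) * (X 0 * X 1) + C (k 5) * X 1 ^ 2 + C (k 6) * X 0 ^ 3 +
      C (k 7) * (X 0 ^ 2 * X 1) + C (k 8) * (X 0 * X 1 ^ 2) + C (k 9) * X 1 ^ 3 +
      C (k 10) * (X 0 ^ 3 * X 1) + C (k 11) * (X 0 * X 1 ^ 3) := by
  simp only [AdiniSpace, Submodule.mem_span_insert, Submodule.mem_span_singleton,
    MvPolynomial.smul_eq_C_mul] at hφ
  obtain ⟨k₀, _, ⟨k₁, _, ⟨k₂, _, ⟨k₃, _, ⟨k₄, _, ⟨k₅, _, ⟨k₆, _, ⟨k₇, _, ⟨k₈, _, ⟨k₉, _,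
    ⟨k₁₀, _, ⟨k₁₁, rfl⟩, rfl⟩, rfl⟩, rfl⟩, rfl⟩, rfl⟩, rfl⟩, rfl⟩, rfl⟩, rfl⟩, rfl⟩, rfl⟩ := hφ
  refine ⟨![k₀, k₁, k₂, k₃, k₄, k₅, k₆, k₇, k₈, k₉, k₁₀, k₁₁], ?_⟩
  simp
  ring

/-- **Lemma l:varphiz10 (a).** For the Adini basis function `φ` of the degree of
freedom `∂ₓ` at `z = (0,0)` on `T = [0,a] × [0,c]`, `∫_T x ∂²ₓₓφ = 0`. -/
theorem adini_dx_xdxx_orth (a b c : ℝ) (ha : 0 < a) (hb : 0 < b) (hc : 0 < c)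
    (φ : MvPolynomial (Fin 2) ℝ) (hφA : φ ∈ AdiniSpace)
    (hφ0 : ∀ β : Fin 3, adiniDof β (0, 0) φ = if β = 1 then 1 else 0)
    (hφv : ∀ β : Fin 3,
      adiniDof β (a, 0) φ = 0 ∧ adiniDof β (a, c) φ = 0 ∧ adiniDof β (0, c) φ = 0) :
    (∫ x in (0 : ℝ)..a, ∫ y in (0 : ℝ)..c, x * pev x y (dX (dX φ))) = 0 := by
  obtain ⟨k, hk⟩ := AdiniSpace.exists_coeffs hφA
  have h00 := hφ0 0
  obtain ⟨ha0, hac, h0c⟩ := hφv 0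
  obtain ⟨hxa0, hxac, -⟩ := hφv 1
  simp [hk, adiniDof, pev, dX, pderiv_X] at h00 ha0 hac h0c hxa0 hxac
  have hxx : ∀ x y : ℝ, x * pev x y (dX (dX φ)) =
      (2 * k 3 * x + 6 * k 6 * x ^ 2) + (2 * k 7 * x + 6 * k 10 * x ^ 2) * y := by
    intro x y
    simp [hk, pev, dX, pderiv_X, pderiv_ofNat]
    ring
  have hy : ∀ x : ℝ, ∫ y in (0 : ℝ)..c, x * pev x y (dX (dX φ)) =
      (2 * k 3 * c + k 7 * c ^ 2) * x + (6 * k 6 * c + 3 * k 10 * c ^ 2) * x ^ 2 := by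
    intro x
    simp only [hxx]
    rw [intervalIntegral.integral_add (Continuous.intervalIntegrable (by fun_prop) _ _)
      (Continuous.intervalIntegrable (by fun_prop) _ _), intervalIntegral.integral_const_mul]
    simp
    ring
  simp only [hy]
  rw [intervalIntegral.integral_add (Continuous.intervalIntegrable (by fun_prop) _ _)
    (Continuous.intervalIntegrable (by fun_prop) _ _), intervalIntegral.integral_const_mul,
    intervalIntegral.integral_const_mul, integral_id, integral_pow]
  linear_combination (c / 2) * (a * hxa0 - ha0 + h00 + a * hxac - hac + h0c)
end

section
/- For every Lebesgue-integrable function q : [0,c] → ℝ one has ∫_T q(y)·∂²ₓᵧφ(x,y) dx dy = 0. -/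
open MvPolynomial MeasureTheory

/-- Every Adini polynomial is a combination of the twelve spanning monomials. -/
theorem exists_coeff_of_mem_adiniSpace_s9 {p : MvPolynomial (Fin 2) ℝ} (hp : p ∈ AdiniSpace) :
    ∃ k : Fin 12 → ℝ, p = k 0 • 1 + (k 1 • X 0 + (k 2 • X 1 + (k 3 • X 0 ^ 2 +
      (k 4 • (X 0 * X 1) + (k 5 • X 1 ^ 2 + (k 6 • X 0 ^ 3 + (k 7 • (X 0 ^ 2 * X 1) +
      (k 8 • (X 0 * X 1 ^ 2) + (k 9 • X 1 ^ 3 + (k 10 • (X 0 ^ 3 * X 1) +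
      k 11 • (X 0 * X 1 ^ 3))))))))))) := by
  simp only [AdiniSpace, Submodule.mem_span_insert, Submodule.mem_span_singleton] at hp
  obtain ⟨k0, _, ⟨k1, _, ⟨k2, _, ⟨k3, _, ⟨k4, _, ⟨k5, _, ⟨k6, _, ⟨k7, _, ⟨k8, _, ⟨k9, _,
    ⟨k10, _, ⟨k11, rfl⟩, rfl⟩, rfl⟩, rfl⟩, rfl⟩, rfl⟩, rfl⟩, rfl⟩, rfl⟩, rfl⟩, rfl⟩, rfl⟩ := hp
  exact ⟨![k0, k1, k2, k3, k4, k5, k6, k7, k8, k9, k10, k11], rfl⟩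

/-- Value, gradient and mixed second derivative of an Adini polynomial in coordinates. -/
theorem exists_pev_of_mem_adiniSpace {p : MvPolynomial (Fin 2) ℝ} (hp : p ∈ AdiniSpace) :
    ∃ k : Fin 12 → ℝ, ∀ x y : ℝ,
      pev x y p = k 0 + k 1 * x + k 2 * y + k 3 * x ^ 2 + k 4 * x * y + k 5 * y ^ 2 +
        k 6 * x ^ 3 + k 7 * x ^ 2 * y + k 8 * x * y ^ 2 + k 9 * y ^ 3 + k 10 * x ^ 3 * y +
        k 11 * x * y ^ 3 ∧
      pev x y (dX p) = k 1 + 2 * k 3 * x + k 4 * y + 3 * k 6 * x ^ 2 + 2 * k 7 * x * y +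
        k 8 * y ^ 2 + 3 * k 10 * x ^ 2 * y + k 11 * y ^ 3 ∧
      pev x y (dY p) = k 2 + k 4 * x + 2 * k 5 * y + k 7 * x ^ 2 + 2 * k 8 * x * y +
        3 * k 9 * y ^ 2 + k 10 * x ^ 3 + 3 * k 11 * x * y ^ 2 ∧
      pev x y (dY (dX p)) = k 4 + 2 * k 7 * x + 2 * k 8 * y + 3 * k 10 * x ^ 2 +
        3 * k 11 * y ^ 2 := by
  obtain ⟨k, rfl⟩ := exists_coeff_of_mem_adiniSpace_s9 hp
  have h2 : pderiv (1 : Fin 2) (2 : MvPolynomial (Fin 2) ℝ) = 0 := Derivation.map_natCast _ 2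
  have h3 : pderiv (1 : Fin 2) (3 : MvPolynomial (Fin 2) ℝ) = 0 := Derivation.map_natCast _ 3
  refine ⟨k, fun x y => ⟨?_, ?_, ?_, ?_⟩⟩ <;>
  · simp [pev, dX, dY, pderiv_X, Derivation.leibniz, Derivation.leibniz_pow, smul_eval, h2, h3]
    try ring

/-- **Lemma l:varphiz10 (b).** For the Adini basis function `φ` of the degree of
freedom `∂ₓ` at `z = (0,0)` on `T = [0,a] × [0,c]` and any integrable
`q = q(y)`, `∫_T q(y) ∂²ₓᵧφ = 0`. -/
theorem adini_dx_dxy_orth (a b c : ℝ) (ha : 0 < a) (hb : 0 < b) (hc : 0 < c)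
    (φ : MvPolynomial (Fin 2) ℝ) (hφA : φ ∈ AdiniSpace)
    (hφ0 : ∀ β : Fin 3, adiniDof β (0, 0) φ = if β = 1 then 1 else 0)
    (hφv : ∀ β : Fin 3,
      adiniDof β (a, 0) φ = 0 ∧ adiniDof β (a, c) φ = 0 ∧ adiniDof β (0, c) φ = 0)
    (q : ℝ → ℝ) (hq : IntegrableOn q (Set.Icc 0 c)) :
    (∫ x in (0 : ℝ)..a, ∫ y in (0 : ℝ)..c, q y * pev x y (dY (dX φ))) = 0 := by
  obtain ⟨k, hk⟩ := exists_pev_of_mem_adiniSpace hφA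
  obtain ⟨-, h2, h3⟩ := hφv 0
  obtain ⟨-, -, h6⟩ := hφv 1
  obtain ⟨h7, h8, h9⟩ := hφv 2
  have h1 := (hφv 0).1
  have h00 := hφ0 0
  have h02 := hφ0 2
  simp [adiniDof, hk] at h1 h2 h3 h6 h7 h8 h9 h00 h02
  have hx : k 4 + k 7 * a + k 10 * a ^ 2 = 0 :=
    mul_left_cancel₀ ha.ne' (by linear_combination h7 - h02)
  have hy0 : k 5 = 0 ∧ k 9 = 0 := by
    have e9 : k 9 = 0 := mul_left_cancel₀ (pow_ne_zero 3 hc.ne')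
      (by linear_combination c * h9 - 2 * h3 + 2 * h00 + c * h02)
    refine ⟨mul_left_cancel₀ (pow_ne_zero 2 hc.ne') ?_, e9⟩
    linear_combination h3 - h00 - c * h02 - c ^ 3 * e9
  obtain ⟨e5, e9⟩ := hy0
  have hv : k 8 + k 11 * c = 0 :=
    mul_left_cancel₀ (mul_ne_zero ha.ne' (pow_ne_zero 2 hc.ne'))
      (by linear_combination h2 - h1 - c * h02 - c ^ 2 * e5 - c ^ 3 * e9 - a * c * hx)
  have hd : 2 * k 8 + 3 * k 11 * c = 0 :=
    mul_left_cancel₀ (mul_ne_zero ha.ne' hc.ne')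
      (by linear_combination h8 - h02 - 2 * c * e5 - 3 * c ^ 2 * e9 - a * hx)
  have e11 : k 11 = 0 := mul_left_cancel₀ hc.ne' (by linear_combination hd - 2 * hv)
  have e8 : k 8 = 0 := by linear_combination hv - c * e11
  have hmixed : ∀ x y, pev x y (dY (dX φ)) = k 4 + 2 * k 7 * x + 3 * k 10 * x ^ 2 := by
    intro x y
    rw [(hk x y).2.2.2, e8, e11]
    ring
  simp only [hmixed, intervalIntegral.integral_mul_const, intervalIntegral.integral_const_mul]
  have hprim : ∀ x ∈ Set.uIcc 0 a, HasDerivAt (fun x => k 4 * x + k 7 * x ^ 2 + k 10 * x ^ 3)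
      (k 4 + 2 * k 7 * x + 3 * k 10 * x ^ 2) x := by
    intro x _
    refine ((((hasDerivAt_id' x).const_mul (k 4)).add ((hasDerivAt_pow 2 x).const_mul (k 7))).add
      ((hasDerivAt_pow 3 x).const_mul (k 10))).congr_deriv ?_
    norm_num
    ring
  rw [intervalIntegral.integral_eq_sub_of_hasDerivAt hprim
    (Continuous.intervalIntegrable (by fun_prop) _ _)]
  linear_combination (a * ∫ y in (0 : ℝ)..c, q y) * hx
end

section
/- Let ρ = a/b. If φ ∈ 𝒜 satisfies φ(0,0) = 1, ∂ₓφ(0,0) = ∂_yφ(0,0) = 0 and φ, ∂ₓφ, ∂_yφ all vanish at the other three vertices (a,0), (a,c), (0,c) of T, and ψ ∈ 𝒜 satisfies ψ(0,0) = 1, ∂ₓψ(0,0) = ∂_yψ(0,0) = 0 and ψ, ∂ₓψ, ∂_yψ all vanish at the other three vertices (−b,0), (−b,c), (0,c) of K, then ψ(x,y) = φ(−ρ·x, y) for all (x,y) ∈ ℝ². -/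
open MvPolynomial MeasureTheory

/-- An element of the Adini space, together with its first partial derivatives, in coordinates. -/
lemma AdiniSpace.exists_coeffs_s14 {p : MvPolynomial (Fin 2) ℝ} (hp : p ∈ AdiniSpace) :
    ∃ k : Fin 12 → ℝ, ∀ x y : ℝ,
      pev x y p = k 0 + k 1 * x + k 2 * y + k 3 * x ^ 2 + k 4 * (x * y) + k 5 * y ^ 2
        + k 6 * x ^ 3 + k 7 * (x ^ 2 * y) + k 8 * (x * y ^ 2) + k 9 * y ^ 3
        + k 10 * (x ^ 3 * y) + k 11 * (x * y ^ 3) ∧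
      pev x y (dX p) = k 1 + 2 * k 3 * x + k 4 * y + 3 * k 6 * x ^ 2 + 2 * k 7 * (x * y)
        + k 8 * y ^ 2 + 3 * k 10 * (x ^ 2 * y) + k 11 * y ^ 3 ∧
      pev x y (dY p) = k 2 + k 4 * x + 2 * k 5 * y + k 7 * x ^ 2 + 2 * k 8 * (x * y)
        + 3 * k 9 * y ^ 2 + k 10 * x ^ 3 + 3 * k 11 * (x * y ^ 2) := by
  simp only [AdiniSpace, Submodule.mem_span_insert, Submodule.mem_span_singleton] at hp
  obtain ⟨k0, _, ⟨k1, _, ⟨k2, _, ⟨k3, _, ⟨k4, _, ⟨k5, _, ⟨k6, _, ⟨k7, _, ⟨k8, _, ⟨k9, _,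
    ⟨k10, _, ⟨k11, rfl⟩, rfl⟩, rfl⟩, rfl⟩, rfl⟩, rfl⟩, rfl⟩, rfl⟩, rfl⟩, rfl⟩, rfl⟩, rfl⟩ := hp
  refine ⟨![k0, k1, k2, k3, k4, k5, k6, k7, k8, k9, k10, k11], fun x y => ?_⟩
  refine ⟨?_, ?_, ?_⟩ <;>
    simp [pev, dX, dY, pderiv_X, Derivation.leibniz, Derivation.leibniz_pow,
      smul_eval] <;>
    ring

/-- The nodal Adini function at the vertex `(0, 0)` of the rectangle with opposite vertex
`(s, c)`, in scaled coordinates. -/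
lemma AdiniSpace.pev_nodal {s c : ℝ} {p : MvPolynomial (Fin 2) ℝ}
    (hp : p ∈ AdiniSpace) (h0 : ∀ β : Fin 3, adiniDof β (0, 0) p = if β = 0 then 1 else 0)
    (hv : ∀ β : Fin 3,
      adiniDof β (s, 0) p = 0 ∧ adiniDof β (s, c) p = 0 ∧ adiniDof β (0, c) p = 0)
    (ξ η : ℝ) :
    pev (s * ξ) (c * η) p
      = (1 - ξ) * (1 - η) * (1 + ξ + η - 2 * ξ ^ 2 - 2 * η ^ 2) := by
  obtain ⟨k, hk⟩ := AdiniSpace.exists_coeffs_s14 hp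
  have a0 := h0 0
  have a1 := h0 1
  have a2 := h0 2
  obtain ⟨b0, c0, d0⟩ := hv 0
  obtain ⟨b1, c1, d1⟩ := hv 1
  obtain ⟨b2, c2, d2⟩ := hv 2
  simp only [adiniDof, (hk _ _).1, (hk _ _).2.1, (hk _ _).2.2, Fin.isValue, if_true,
    one_ne_zero, if_false, show (2 : Fin 3) ≠ 0 by decide, show (2 : Fin 3) ≠ 1 by decide]
    at a0 a1 a2 b0 b1 b2 c0 c1 c2 d0 d1 d2
  rw [(hk _ _).1]
  replace a1 : k 1 = 0 := by linarith
  replace a2 : k 2 = 0 := by linarith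
  replace a0 : k 0 = 1 := by linarith
  replace b1 := congrArg (s * ·) b1
  replace c1 := congrArg (s * ·) c1
  replace d1 := congrArg (s * ·) d1
  replace b2 := congrArg (c * ·) b2
  replace c2 := congrArg (c * ·) c2
  replace d2 := congrArg (c * ·) d2
  simp only [a0, a1, a2] at b0 b1 b2 c0 c1 c2 d0 d1 d2 ⊢
  have e3 : k 3 * s ^ 2 = -3 := by linarith
  have e6 : k 6 * s ^ 3 = 2 := by linarith
  have e5 : k 5 * c ^ 2 = -3 := by linarith
  have e9 : k 9 * c ^ 3 = 2 := by linarith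
  have e4 : k 4 * (s * c) = -1 := by linarith
  have e7 : k 7 * (s ^ 2 * c) = 3 := by linarith
  have e8 : k 8 * (s * c ^ 2) = 3 := by linarith
  have e10 : k 10 * (s ^ 3 * c) = -2 := by linarith
  have e11 : k 11 * (s * c ^ 3) = -2 := by linarith
  linear_combination ξ ^ 2 * e3 + ξ ^ 3 * e6 + η ^ 2 * e5 + η ^ 3 * e9 + ξ * η * e4
    + ξ ^ 2 * η * e7 + ξ * η ^ 2 * e8 + ξ ^ 3 * η * e10 + ξ * η ^ 3 * e11

/-- **Reflection symmetry of nodal Adini basis functions.** With `ρ = a/b`, the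
nodal basis functions `φ` on `T = [0,a]×[0,c]` and `ψ` on `K = [−b,0]×[0,c]`
of the shared vertex `z = (0,0)` satisfy `ψ(x,y) = φ(−ρx, y)`. -/
theorem adini_nodal_symmetry (a b c : ℝ) (ha : 0 < a) (hb : 0 < b) (hc : 0 < c)
    (φ ψ : MvPolynomial (Fin 2) ℝ) (hφA : φ ∈ AdiniSpace) (hψA : ψ ∈ AdiniSpace)
    (hφ0 : ∀ β : Fin 3, adiniDof β (0, 0) φ = if β = 0 then 1 else 0)
    (hφv : ∀ β : Fin 3,
      adiniDof β (a, 0) φ = 0 ∧ adiniDof β (a, c) φ = 0 ∧ adiniDof β (0, c) φ = 0)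
    (hψ0 : ∀ β : Fin 3, adiniDof β (0, 0) ψ = if β = 0 then 1 else 0)
    (hψv : ∀ β : Fin 3,
      adiniDof β (-b, 0) ψ = 0 ∧ adiniDof β (-b, c) ψ = 0 ∧ adiniDof β (0, c) ψ = 0) :
    ∀ x y : ℝ, pev x y ψ = pev (-(a / b) * x) y φ := by
  intro x y
  have h₁ := AdiniSpace.pev_nodal hψA hψ0 hψv (-x / b) (y / c)
  have h₂ := AdiniSpace.pev_nodal hφA hφ0 hφv (-x / b) (y / c)
  rw [show -b * (-x / b) = x by field_simp, mul_div_cancel₀ y hc.ne'] at h₁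
  rw [show a * (-x / b) = -(a / b) * x by ring, mul_div_cancel₀ y hc.ne'] at h₂
  rw [h₁, h₂]
end
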